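/- If A is an R0-tensor and Sol(A,a) ≠ ∅, then the map Sol_A : b ↦ Sol(A,b) is locally upper-Hölder at a: there exist γ > 0, c > 0 and ε > 0 such that for every b ∈ ℝ^n with ‖b − a‖ < ε, one has Sol(A,b) ⊆ Sol(A,a) + γ‖b − a‖^c · B̄(0,1), where B̄(0,1) is the closed unit ball of ℝ^n and + denotes Minkowski sum. -/

import Mathlib

open Finset MeasureTheory Pointwise

/-- For a tensor `A` of order `k+1` and dimension `n` (entries `A i j` = `a_{i, j 0, …, j (k-1)}`),
`tApply A x` is the vector `A x^{k}` with `i`-th component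
`∑_{i_2,…,i_{k+1}} a_{i i_2 ⋯ i_{k+1}} x_{i_2} ⋯ x_{i_{k+1}}`. -/
noncomputable def tApply {n k : ℕ} (A : Fin n → (Fin k → Fin n) → ℝ) (x : Fin n → ℝ) :
    Fin n → ℝ :=
  fun i => ∑ j : Fin k → Fin n, A i j * ∏ l : Fin k, x (j l)

/-- The solution set of the tensor complementarity problem `TCP(A,a)`. -/
def Sol {n k : ℕ} (A : Fin n → (Fin k → Fin n) → ℝ) (a : Fin n → ℝ) : Set (Fin n → ℝ) :=
  {x | (∀ i, 0 ≤ x i) ∧ (∀ i, 0 ≤ tApply A x i + a i) ∧ ∑ i, x i * (tApply A x i + a i) = 0}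

/-- `A` is an R₀-tensor if `Sol(A,0) = {0}`. -/
def IsR0 {n k : ℕ} (A : Fin n → (Fin k → Fin n) → ℝ) : Prop := Sol A 0 = {0}

/-- Frobenius norm of a tensor. -/
noncomputable def tNorm {n k : ℕ} (A : Fin n → (Fin k → Fin n) → ℝ) : ℝ :=
  Real.sqrt (∑ i, ∑ j, (A i j) ^ 2)

/-- Euclidean norm of a vector in ℝⁿ. -/
noncomputable def eNorm {n : ℕ} (x : Fin n → ℝ) : ℝ := Real.sqrt (∑ i, (x i) ^ 2)

open Polynomial

/-! ### Coefficient fields for convex valuation rings -/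

section coeffField

variable {K : Type*} [Field K] [LinearOrder K] [IsStrictOrderedRing K]

/-- elements of subpolynomial growth with respect to `w` -/
def Bnd (w y : K) : Prop := ∀ j : ℕ, |y| ^ j < w

/-- elements polynomially small with respect to `w` -/
def Sml (w y : K) : Prop := ∃ j : ℕ, |y| ^ j * w ≤ 1

variable {w : K}


lemma w_pos (hw : ∀ k : ℕ, (k : K) < w) : 0 < w := by simpa using hw 0

lemma Bnd.mono {y z : K} (h : Bnd w z) (hyz : |y| ≤ |z|) : Bnd w y := fun j =>
  (pow_le_pow_left₀ (abs_nonneg _) hyz j).trans_lt (h j)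

lemma Sml.mono {y z : K} (hw0 : 0 < w) (h : Sml w z) (hyz : |y| ≤ |z|) : Sml w y := by
  obtain ⟨j, hj⟩ := h
  exact ⟨j, (mul_le_mul_of_nonneg_right (pow_le_pow_left₀ (abs_nonneg _) hyz j) hw0.le).trans hj⟩

lemma bnd_nat (hw : ∀ k : ℕ, (k : K) < w) (k : ℕ) : Bnd w (k : K) := fun j => by
  rw [Nat.abs_cast]; exact_mod_cast hw (k ^ j)

lemma Bnd.mul {y z : K} (hy : Bnd w y) (hz : Bnd w z) : Bnd w (y * z) := by
  rcases le_total |y| |z| with h | h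
  · intro j
    have := hz (2 * j)
    refine lt_of_le_of_lt ?_ this
    rw [pow_mul, abs_mul, sq]
    exact pow_le_pow_left₀ (by positivity) (mul_le_mul_of_nonneg_right h (abs_nonneg _)) j
  · intro j
    have := hy (2 * j)
    refine lt_of_le_of_lt ?_ this
    rw [pow_mul, abs_mul, sq]
    exact pow_le_pow_left₀ (by positivity) (mul_le_mul_of_nonneg_left h (abs_nonneg _)) j

lemma Bnd.add (hw : ∀ k : ℕ, (k : K) < w) {y z : K} (hy : Bnd w y) (hz : Bnd w z) : Bnd w (y + z) := by
  have h2 := bnd_nat hw 2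
  rcases le_total |y| |z| with h | h
  · refine (h2.mul hz).mono ?_
    refine (abs_add_le _ _).trans ?_
    rw [abs_mul]; simp; linarith
  · refine (h2.mul hy).mono ?_
    refine (abs_add_le _ _).trans ?_
    rw [abs_mul]; simp; linarith

/-- the convex subring -/
def bndRing (hw : ∀ k : ℕ, (k : K) < w) : Subring K where
  carrier := {y | Bnd w y}
  mul_mem' := Bnd.mul
  add_mem' := Bnd.add hw
  one_mem' := by simpa using bnd_nat hw 1
  zero_mem' := by simpa using bnd_nat hw 0
  neg_mem' := fun {y} h => h.mono (by simp)

lemma mem_bndRing (hw : ∀ k : ℕ, (k : K) < w) {y : K} : y ∈ bndRing hw ↔ Bnd w y := Iff.rfl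

lemma sml_zero (hw : ∀ k : ℕ, (k : K) < w) : Sml w (0 : K) := ⟨1, by simp⟩

lemma sml_iff {y : K} (hy : y ≠ 0) : Sml w y ↔ ¬ Bnd w y⁻¹ := by
  have : 0 < |y| := abs_pos.2 hy
  simp only [Sml, Bnd, not_forall, not_lt, abs_inv, inv_pow]
  refine exists_congr fun j => ?_
  rw [mul_comm, ← le_div_iff₀ (by positivity), one_div]

lemma Sml.lt (hw : ∀ k : ℕ, (k : K) < w) {y : K} (hy : Sml w y) (k : ℕ) (hk : 0 < k) : |y| < (k : K)⁻¹ := by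
  obtain ⟨j, hj⟩ := hy
  by_contra! h
  have h0 : (0 : K) < k := by exact_mod_cast hk
  have h1 : ((k : K)⁻¹) ^ j ≤ |y| ^ j := pow_le_pow_left₀ (by positivity) h j
  have h2 : ((k : K)⁻¹) ^ j * w ≤ 1 :=
    (mul_le_mul_of_nonneg_right h1 (w_pos hw).le).trans hj
  have h3 := hw (k ^ j)
  push_cast at h3
  rw [inv_pow, inv_mul_le_iff₀ (by positivity)] at h2
  linarith

lemma Sml.bnd (hw : ∀ k : ℕ, (k : K) < w) {y : K} (hy : Sml w y) : Bnd w y := by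
  have := hy.lt hw 1 one_pos
  refine (bnd_nat hw 1).mono ?_
  simp at this ⊢; exact this.le

lemma Sml.mul_bnd (hw : ∀ k : ℕ, (k : K) < w) {y z : K} (hy : Sml w y) (hz : Bnd w z) : Sml w (y * z) := by
  by_cases h0 : y * z = 0
  · rw [h0]; exact sml_zero hw
  have hy0 : y ≠ 0 := left_ne_zero_of_mul h0
  have hz0 : z ≠ 0 := right_ne_zero_of_mul h0
  rw [sml_iff h0]
  rw [sml_iff hy0] at hy
  intro h
  apply hy
  have := hz.mul h
  convert this using 1
  field_simp

lemma Sml.add (hw : ∀ k : ℕ, (k : K) < w) {y z : K} (hy : Sml w y) (hz : Sml w z) : Sml w (y + z) := by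
  have h2 := bnd_nat hw 2
  rcases le_total |y| |z| with h | h
  · refine (hz.mul_bnd hw h2).mono (w_pos hw) ?_
    refine (abs_add_le _ _).trans ?_
    rw [abs_mul]; simp; linarith
  · refine (hy.mul_bnd hw h2).mono (w_pos hw) ?_
    refine (abs_add_le _ _).trans ?_
    rw [abs_mul]; simp; linarith

lemma Sml.neg (hw : ∀ k : ℕ, (k : K) < w) {y : K} (hy : Sml w y) : Sml w (-y) := hy.mono (w_pos hw) (by simp)

/-- Newton / Hensel step, using the intermediate value property for polynomials. -/
lemma newton (hw : ∀ k : ℕ, (k : K) < w) (ivt : ∀ (p : K[X]) (u v : K), u ≤ v → p.eval u < 0 → 0 < p.eval v →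
      ∃ t, u ≤ t ∧ t ≤ v ∧ p.eval t = 0)
    (p : (bndRing hw)[X]) (x : bndRing hw) (hp : Sml w ((p.eval x : bndRing hw) : K))
    (hd : ¬ Sml w ((p.derivative.eval x : bndRing hw) : K)) :
    ∃ t : K, Sml w (t - x) ∧ (p.map (bndRing hw).subtype).eval t = 0 := by
  have hev : ∀ y : bndRing hw, (p.map (bndRing hw).subtype).eval (y : K) = (p.eval y : bndRing hw) := by
    intro y
    exact Polynomial.eval_map_apply (f := (bndRing hw).subtype) y
  set D : K := ((p.derivative.eval x : bndRing hw) : K) with hD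
  set e : K := ((p.eval x : bndRing hw) : K) with he
  have hD0 : D ≠ 0 := fun h => hd (h ▸ sml_zero hw)
  have hDi : Bnd w D⁻¹ := by
    by_contra h; exact hd ((sml_iff hD0).2 h)
  by_cases he0 : e = 0
  · exact ⟨x, by simpa using sml_zero hw, by rw [hev, ← he, he0]⟩
  have hq : Sml w (e * D⁻¹) := hp.mul_bnd hw hDi
  have hη : Sml w (2 * |e * D⁻¹|) := by
    have := hq.mul_bnd hw (bnd_nat hw 2)
    refine this.mono (w_pos hw) ?_
    rw [abs_mul, abs_mul (e * D⁻¹)]; simp [mul_comm]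
  set η : K := 2 * |e * D⁻¹| with hηd
  have hη0 : 0 < η := by positivity
  have heD : |D * e| = D ^ 2 * η / 2 := by
    rw [hηd, abs_mul, abs_mul, abs_inv, ← sq_abs D]
    field_simp
  have key : ∀ h : K, |h| = η → |D * (p.map (bndRing hw).subtype).eval ((x : K) + h) - D ^ 2 * h| <
      D ^ 2 * η := by
    intro h hh
    have hs : Sml w h := hη.mono (w_pos hw) (by rw [hh, abs_of_pos hη0])
    obtain ⟨k, hk⟩ := Polynomial.binomExpansion p x ⟨h, hs.bnd hw⟩
    have h1 := hev (x + ⟨h, hs.bnd hw⟩)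
    rw [hk] at h1
    push_cast at h1
    rw [h1, ← he, ← hD]
    have hk1 : Sml w (h * (k * D⁻¹)) := hs.mul_bnd hw (Bnd.mul k.2 hDi)
    have hk2 := hk1.lt hw 2 (by norm_num)
    have : D * (e + D * h + k * h ^ 2) - D ^ 2 * h = D * e + D ^ 2 * h * (h * (k * D⁻¹)) := by
      field_simp; ring
    rw [this]
    refine (abs_add_le _ _).trans_lt ?_
    rw [heD, abs_mul, abs_mul, hh, abs_of_nonneg (sq_nonneg D)]
    have hpos : 0 < D ^ 2 * η := by positivity
    have := mul_lt_mul_of_pos_left hk2 hpos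
    push_cast at this
    linarith
  obtain ⟨t, ht1, ht2, ht3⟩ := ivt (C D * p.map (bndRing hw).subtype) (x - η) (x + η) (by linarith)
    (by
      have := key (-η) (by simp [abs_of_pos hη0])
      rw [abs_lt] at this
      rw [eval_mul, eval_C, sub_eq_add_neg]
      linarith [this.2])
    (by
      have := key η (by simp [abs_of_pos hη0])
      rw [abs_lt] at this
      rw [eval_mul, eval_C]
      linarith [this.1])
  refine ⟨t, hη.mono (w_pos hw) ?_, ?_⟩
  · rw [abs_of_pos hη0, abs_le]; constructor <;> linarith
  · rw [eval_mul, eval_C] at ht3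
    exact (mul_eq_zero.1 ht3).resolve_left hD0

/-- A coefficient field containing a given subfield. -/
lemma exists_coeff_field (hw : ∀ k : ℕ, (k : K) < w) (ivt : ∀ (p : K[X]) (u v : K), u ≤ v → p.eval u < 0 → 0 < p.eval v →
      ∃ t, u ≤ t ∧ t ≤ v ∧ p.eval t = 0)
    (k₀ : Subfield K) (hk₀ : ∀ y ∈ k₀, Bnd w y) :
    ∃ L : Subfield K, k₀ ≤ L ∧ (∀ y ∈ L, Bnd w y) ∧ ∀ x, Bnd w x → ∃ y ∈ L, Sml w (y - x) := by
  obtain ⟨L, hL0, hLmax⟩ := zorn_le_nonempty₀ {L : Subfield K | ∀ y ∈ L, Bnd w y} (by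
    intro c hc hch y hy
    refine ⟨sSup c, ?_, fun z hz => le_sSup hz⟩
    intro z hz
    rw [Subfield.mem_sSup_of_directedOn ⟨y, hy⟩ hch.directedOn] at hz
    obtain ⟨s, hs, hzs⟩ := hz
    exact hc hs z hzs) k₀ hk₀
  have hLb : ∀ y ∈ L, Bnd w y := hLmax.prop
  refine ⟨L, hL0, hLb, fun x hx => ?_⟩
  -- adjoining an element
  have hadj : ∀ t : K, (∀ z ∈ IntermediateField.adjoin L {t}, Bnd w z) → t ∈ L := by
    intro t ht
    have h1 : (IntermediateField.adjoin L {t}).toSubfield ∈ {L : Subfield K | ∀ y ∈ L, Bnd w y} := ht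
    have h2 : L ≤ (IntermediateField.adjoin L {t}).toSubfield := by
      intro z hz
      exact (IntermediateField.adjoin L {t}).algebraMap_mem ⟨z, hz⟩
    exact hLmax.le_of_ge h1 h2 (IntermediateField.mem_adjoin_simple_self L t)
  have hLO : L.toSubring ≤ bndRing hw := hLb
  let ι : L →+* bndRing hw := Subring.inclusion hLO
  have hι : ∀ (p : L[X]), (p.map ι).map (bndRing hw).subtype = p.map (algebraMap L K) := by
    intro p
    rw [Polynomial.map_map]; rfl
  have haev : ∀ (p : L[X]) (t : bndRing hw), aeval (t : K) p = (((p.map ι).eval t : bndRing hw) : K) := by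
    intro p t
    rw [aeval_def, ← eval_map, ← hι]
    exact Polynomial.eval_map_apply (f := (bndRing hw).subtype) t
  have hbev : ∀ (p : L[X]) (t : K), Bnd w t → Bnd w (aeval t p) := by
    intro p t ht
    rw [haev p ⟨t, ht⟩]
    exact Subtype.prop _
  by_cases hcase : ∃ p : L[X], p ≠ 0 ∧ Sml w (aeval x p)
  · classical
    have hex : ∃ d : ℕ, ∃ p : L[X], p ≠ 0 ∧ Sml w (aeval x p) ∧ p.natDegree = d := by
      obtain ⟨p, h1, h2⟩ := hcase
      exact ⟨_, p, h1, h2, rfl⟩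
    obtain ⟨p, hp0, hps, hpd⟩ := Nat.find_spec hex
    have hpmin : ∀ q : L[X], q ≠ 0 → q.natDegree < p.natDegree → ¬ Sml w (aeval x q) := by
      intro q hq hlt hs
      rw [hpd] at hlt
      exact Nat.find_min hex hlt ⟨q, hq, hs, rfl⟩
    have hdeg : p.natDegree ≠ 0 := by
      intro h0
      obtain ⟨c, hc⟩ := natDegree_eq_zero.1 h0
      have hc0 : c ≠ 0 := by
        rintro rfl
        exact hp0 (by simpa using hc.symm)
      have hcK : (c : K) ≠ 0 := by simpa using hc0
      rw [← hc, aeval_C] at hps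
      exact (sml_iff hcK).1 hps (hLb _ (L.inv_mem c.2))
    have hder0 : p.derivative ≠ 0 := by
      intro h
      exact hdeg (Polynomial.derivative_eq_zero.1 h)
    have hder : ¬ Sml w (aeval x p.derivative) :=
      hpmin _ hder0 (natDegree_derivative_lt hdeg)
    obtain ⟨t, ht, hroot⟩ := newton hw ivt (p.map ι) ⟨x, hx⟩ (by rw [← haev]; exact hps)
      (by rw [derivative_map, ← haev]; exact hder)
    refine ⟨t, hadj t ?_, ht⟩
    have hbt : Bnd w t := by
      have := (ht.bnd hw).add hw hx
      simpa using this
    have halg : IsAlgebraic L t := by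
      refine ⟨p, hp0, ?_⟩
      rw [hι, eval_map] at hroot
      rw [aeval_def]; exact hroot
    intro z hz
    have h1 : z ∈ (IntermediateField.adjoin L {t}).toSubalgebra := hz
    rw [IntermediateField.adjoin_simple_toSubalgebra_of_isAlgebraic halg,
      Algebra.adjoin_singleton_eq_range_aeval] at h1
    obtain ⟨q, rfl⟩ := h1
    exact hbev q t hbt
  · push Not at hcase
    refine ⟨x, hadj x ?_, by simpa using sml_zero hw⟩
    intro z hz
    obtain ⟨r, s, rfl⟩ := (IntermediateField.mem_adjoin_simple_iff L z).1 hz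
    by_cases hs : s = 0
    · simpa [hs] using bnd_nat hw 0
    rw [div_eq_mul_inv]
    refine (hbev r x hx).mul ?_
    by_contra h
    have hne : aeval x s ≠ 0 := fun h0 => hcase s hs (h0 ▸ sml_zero hw)
    exact hcase s hs ((sml_iff hne).2 h)

end coeffField

section transfer

open Filter

/-- the quotient map from real sequences to hyperreals -/
noncomputable def hT : (ℕ → ℝ) →+* Hyperreal where
  toFun f := ((f : Germ (hyperfilter ℕ : Filter ℕ) ℝ) : Germ (hyperfilter ℕ : Filter ℕ) ℝ)
  map_one' := rfl
  map_mul' _ _ := rfl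
  map_zero' := rfl
  map_add' _ _ := rfl

lemma hT_surj (x : Hyperreal) : ∃ f, hT f = x := Quotient.exists_rep x

lemma hT_lt {f g : ℕ → ℝ} : hT f < hT g ↔ ∀ᶠ k in (hyperfilter ℕ : Filter ℕ), f k < g k :=
  Germ.coe_lt

lemma hT_le {f g : ℕ → ℝ} : hT f ≤ hT g ↔ ∀ᶠ k in (hyperfilter ℕ : Filter ℕ), f k ≤ g k :=
  Germ.coe_le

lemma hT_eq {f g : ℕ → ℝ} : hT f = hT g ↔ ∀ᶠ k in (hyperfilter ℕ : Filter ℕ), f k = g k :=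
  Germ.coe_eq

lemma hT_eval (c : ℕ → ℕ → ℝ) (N : ℕ) (u : ℕ → ℝ) :
    hT (fun k => ∑ i ∈ range N, c i k * u k ^ i) = ∑ i ∈ range N, hT (c i) * hT u ^ i := by
  simp only [← map_pow, ← map_mul, ← map_sum]
  congr 1
  ext k
  simp

lemma hyper_ivt (p : Hyperreal[X]) (u v : Hyperreal) (huv : u ≤ v) (hu : p.eval u < 0)
    (hv : 0 < p.eval v) : ∃ t, u ≤ t ∧ t ≤ v ∧ p.eval t = 0 := by
  obtain ⟨u, rfl⟩ := hT_surj u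
  obtain ⟨v, rfl⟩ := hT_surj v
  choose c hc using fun i => hT_surj (p.coeff i)
  have hev : ∀ f : ℕ → ℝ, p.eval (hT f) =
      hT (fun k => ∑ i ∈ range (p.natDegree + 1), c i k * f k ^ i) := by
    intro f
    rw [hT_eval, Polynomial.eval_eq_sum_range]
    simp only [hc]
  rw [hev, ← map_zero hT, hT_lt] at hu hv
  rw [hT_le] at huv
  have : ∀ᶠ k in (hyperfilter ℕ : Filter ℕ), ∃ t : ℝ, u k ≤ t ∧ t ≤ v k ∧
      ∑ i ∈ range (p.natDegree + 1), c i k * t ^ i = 0 := by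
    filter_upwards [huv, hu, hv] with k h1 h2 h3
    have hcont : ContinuousOn (fun t : ℝ => ∑ i ∈ range (p.natDegree + 1), c i k * t ^ i)
        (Set.Icc (u k) (v k)) := by fun_prop
    obtain ⟨t, ht, ht0⟩ := intermediate_value_Icc h1 hcont ⟨h2.le, h3.le⟩
    exact ⟨t, ht.1, ht.2, ht0⟩
  obtain ⟨t, ht⟩ := this.choice
  refine ⟨hT t, hT_le.2 (ht.mono fun _ h => h.1), hT_le.2 (ht.mono fun _ h => h.2.1), ?_⟩
  rw [hev, ← map_zero hT, hT_eq]
  exact ht.mono fun _ h => h.2.2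

/-- constant embedding -/
noncomputable def hC : ℝ →+* Hyperreal := hT.comp (Pi.constRingHom ℕ ℝ)

lemma hC_apply (r : ℝ) : hC r = hT (fun _ => r) := rfl

/-- hyperreal version of `tApply` -/
noncomputable def hApply {n k : ℕ} (A : Fin n → (Fin k → Fin n) → ℝ) (x : Fin n → Hyperreal) :
    Fin n → Hyperreal :=
  fun i => ∑ j : Fin k → Fin n, hC (A i j) * ∏ l : Fin k, x (j l)

lemma hT_tApply {n k : ℕ} (A : Fin n → (Fin k → Fin n) → ℝ) (x : ℕ → Fin n → ℝ) (i : Fin n) :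
    hT (fun s => tApply A (x s) i) = hApply A (fun i => hT (fun s => x s i)) i := by
  simp only [hApply, hC_apply, ← map_prod, ← map_mul, ← map_sum]
  congr 1
  ext s
  simp [tApply]

/-- congruence of bounded elements -/
def Cng (w x y : Hyperreal) : Prop := Bnd w x ∧ Bnd w y ∧ Sml w (x - y)

variable {w : Hyperreal}


lemma Cng.rfl' (hw : ∀ k : ℕ, (k : Hyperreal) < w) {x : Hyperreal} (hx : Bnd w x) : Cng w x x := ⟨hx, hx, by simpa using sml_zero hw⟩

lemma Cng.add (hw : ∀ k : ℕ, (k : Hyperreal) < w) {x y x' y' : Hyperreal} (h : Cng w x y) (h' : Cng w x' y') :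
    Cng w (x + x') (y + y') := by
  refine ⟨h.1.add hw h'.1, h.2.1.add hw h'.2.1, ?_⟩
  have := h.2.2.add hw h'.2.2
  convert this using 1; ring

lemma Cng.mul (hw : ∀ k : ℕ, (k : Hyperreal) < w) {x y x' y' : Hyperreal} (h : Cng w x y) (h' : Cng w x' y') :
    Cng w (x * x') (y * y') := by
  refine ⟨h.1.mul h'.1, h.2.1.mul h'.2.1, ?_⟩
  have := (h.2.2.mul_bnd hw h'.1).add hw (h'.2.2.mul_bnd hw h.2.1)
  convert this using 1; ring

lemma Cng.sum (hw : ∀ k : ℕ, (k : Hyperreal) < w) {ι : Type*} (s : Finset ι) {f g : ι → Hyperreal} (h : ∀ i, Cng w (f i) (g i)) :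
    Cng w (∑ i ∈ s, f i) (∑ i ∈ s, g i) :=
  Finset.sum_hom_rel (Cng.rfl' hw (by simpa using bnd_nat hw 0)) fun i _ _ hh => (h i).add hw hh

lemma Cng.prod (hw : ∀ k : ℕ, (k : Hyperreal) < w) {ι : Type*} (s : Finset ι) {f g : ι → Hyperreal} (h : ∀ i, Cng w (f i) (g i)) :
    Cng w (∏ i ∈ s, f i) (∏ i ∈ s, g i) :=
  Finset.prod_hom_rel (Cng.rfl' hw (by simpa using bnd_nat hw 1)) fun i _ _ hh => (h i).mul hw hh

lemma abs_hT (f : ℕ → ℝ) : |hT f| = hT (fun k => |f k|) := Filter.Germ.abs_def _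

lemma bnd_hC (hw : ∀ k : ℕ, (k : Hyperreal) < w) (r : ℝ) : Bnd w (hC r) := by
  obtain ⟨N, hN⟩ := exists_nat_ge |r|
  refine (bnd_nat hw N).mono ?_
  rw [hC_apply, abs_hT, ← map_natCast hT, abs_hT, hT_le]
  refine Eventually.of_forall fun k => ?_
  simpa using hN

lemma Cng.hApply (hw : ∀ k : ℕ, (k : Hyperreal) < w) {n k : ℕ} (A : Fin n → (Fin k → Fin n) → ℝ) {x y : Fin n → Hyperreal}
    (h : ∀ i, Cng w (x i) (y i)) (i : Fin n) : Cng w (hApply A x i) (hApply A y i) := by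
  unfold _root_.hApply
  exact Cng.sum hw _ fun j => (Cng.rfl' hw (bnd_hC hw _)).mul hw (Cng.prod hw _ fun l => h _)

/-- elements of the coefficient field that are congruent to nonnegative elements -/
lemma nonneg_of_cng (hw : ∀ k : ℕ, (k : Hyperreal) < w) (L : Subfield Hyperreal) (hL : ∀ y ∈ L, Bnd w y) {x y : Hyperreal}
    (hy : y ∈ L) (h : Cng w y x) (hx : 0 ≤ x) : 0 ≤ y := by
  by_contra! hneg
  have hs : Sml w y := h.2.2.mono (w_pos hw) (by
    rw [abs_of_neg hneg, abs_of_neg (by linarith)]; linarith)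
  exact (sml_iff hneg.ne).1 hs (hL _ (L.inv_mem hy))

lemma zero_of_cng (hw : ∀ k : ℕ, (k : Hyperreal) < w) (L : Subfield Hyperreal) (hL : ∀ y ∈ L, Bnd w y) {y : Hyperreal}
    (hy : y ∈ L) (h : Cng w y 0) : y = 0 := by
  by_contra hne
  have hs : Sml w y := by simpa using h.2.2
  exact (sml_iff hne).1 hs (hL _ (L.inv_mem hy))

lemma main_seq {n k : ℕ} (A : Fin n → (Fin k → Fin n) → ℝ) (a : Fin n → ℝ) (M : ℝ)
    (b x : ℕ → Fin n → ℝ) (δ : ℕ → ℝ) (hδ : ∀ s, 0 < δ s) (hδ1 : ∀ s, δ s < 1 / ((s : ℝ) + 1))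
    (hb : ∀ s i, |b s i - a i| ≤ δ s) (hx : ∀ s, x s ∈ Sol A (b s)) (hM : ∀ s i, |x s i| ≤ M) :
    ∃ j : ℕ, ∀ᶠ s in (hyperfilter ℕ : Filter ℕ), ∃ y ∈ Sol A a,
      (∑ i, (y i - x s i) ^ 2) ^ j ≤ δ s := by
  set w : Hyperreal := hT (fun s => (δ s)⁻¹) with hwd
  have hw : ∀ k : ℕ, (k : Hyperreal) < w := by
    intro k
    rw [← map_natCast hT, hwd, hT_lt]
    have : ∀ᶠ s : ℕ in (hyperfilter ℕ : Filter ℕ), k ≤ s :=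
      Nat.hyperfilter_le_atTop (eventually_ge_atTop k)
    filter_upwards [this] with s hs
    have h1 := hδ1 s
    rw [lt_one_div (hδ s) (by positivity), one_div] at h1
    have h2 : (k : ℝ) ≤ s := by exact_mod_cast hs
    simp only [Pi.natCast_apply]
    linarith
  obtain ⟨L, hL0, hLb, hLs⟩ := exists_coeff_field hw hyper_ivt hC.fieldRange (by
    rintro _ ⟨r, rfl⟩
    exact bnd_hC hw r)
  have hCL : ∀ r, hC r ∈ L := fun r => hL0 ⟨r, rfl⟩
  set X : Fin n → Hyperreal := fun i => hT (fun s => x s i) with hXd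
  set B : Fin n → Hyperreal := fun i => hT (fun s => b s i) with hBd
  have hXb : ∀ i, Bnd w (X i) := by
    intro i
    refine (bnd_hC hw M).mono ?_
    rw [hC_apply, abs_hT, abs_hT, hT_le]
    exact Eventually.of_forall fun s => (hM s i).trans (le_abs_self _)
  choose Y hYL hYs using fun i => hLs (X i) (hXb i)
  have hXY : ∀ i, Cng w (Y i) (X i) := fun i => ⟨hLb _ (hYL i), hXb i, hYs i⟩
  have hBa : ∀ i, Cng w (hC (a i)) (B i) := by
    intro i
    have hs : Sml w (hC (a i) - B i) := by
      refine ⟨1, ?_⟩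
      rw [hC_apply, hBd, ← map_sub, abs_hT, pow_one, hwd, ← map_mul, ← map_one hT, hT_le]
      refine Eventually.of_forall fun s => ?_
      have h1 := hb s i
      have h2 := hδ s
      simp only [Pi.mul_apply, Pi.sub_apply, Pi.one_apply]
      rw [abs_sub_comm, ← div_eq_mul_inv, div_le_one h2]
      exact h1
    refine ⟨bnd_hC hw _, ?_, hs⟩
    have := (bnd_hC hw (a i)).add hw ((hs.neg hw).bnd hw)
    simpa using this
  have hAL : ∀ i, hApply A Y i ∈ L := fun i =>
    sum_mem fun j _ => mul_mem (hCL _) (prod_mem fun l _ => hYL _)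
  have hG : ∀ i, Cng w (hApply A Y i + hC (a i)) (hApply A X i + B i) := fun i =>
    (Cng.hApply hw A hXY i).add hw (hBa i)
  have hAX : ∀ i, hApply A X i + B i = hT (fun s => tApply A (x s) i + b s i) := by
    intro i
    rw [← hT_tApply, ← map_add]; rfl
  have f1 : ∀ i, 0 ≤ Y i := fun i => nonneg_of_cng hw L hLb (hYL i) (hXY i) (by
    rw [← map_zero hT, hT_le]; exact Eventually.of_forall fun s => (hx s).1 i)
  have f2 : ∀ i, 0 ≤ hApply A Y i + hC (a i) := fun i =>
    nonneg_of_cng hw L hLb (add_mem (hAL i) (hCL _)) (hG i) (by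
      rw [hAX, ← map_zero hT, hT_le]; exact Eventually.of_forall fun s => (hx s).2.1 i)
  have f3 : ∑ i, Y i * (hApply A Y i + hC (a i)) = 0 := by
    have h0 : ∑ i, X i * (hApply A X i + B i) = 0 := by
      have h1 : ∀ i, X i * (hApply A X i + B i) =
          hT ((fun s => x s i) * (fun s => tApply A (x s) i + b s i)) := by
        intro i
        rw [hAX, map_mul]
      rw [Finset.sum_congr rfl fun i _ => h1 i, ← map_sum, ← map_zero hT]
      congr 1
      ext s
      simpa using (hx s).2.2
    refine zero_of_cng hw L hLb (sum_mem fun i _ => mul_mem (hYL i) (add_mem (hAL i) (hCL _))) ?_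
    rw [← h0]
    exact Cng.sum hw _ fun i => (hXY i).mul hw (hG i)
  have f4 : Sml w (∑ i, (Y i - X i) ^ 2) := by
    have : Cng w (∑ i, (Y i - X i) ^ 2) (∑ i : Fin n, 0) := by
      refine Cng.sum hw _ fun i => ?_
      have hc : Cng w (Y i - X i) 0 := ⟨(hYs i).bnd hw, by simpa using bnd_nat hw 0, by simpa using hYs i⟩
      have := hc.mul hw hc
      rw [mul_zero] at this
      rwa [sq]
    simpa using this.2.2
  choose y hy using fun i => hT_surj (Y i)
  obtain ⟨j, hj⟩ := f4
  refine ⟨j, ?_⟩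
  have e1 : ∀ᶠ s in (hyperfilter ℕ : Filter ℕ), ∀ i, 0 ≤ y i s := by
    rw [eventually_all]; intro i
    rw [← hT_le (f := fun _ => 0)]
    have := f1 i
    rw [← hy] at this
    exact this
  have hAY : ∀ i, hApply A Y i + hC (a i) = hT (fun s => tApply A (fun i => y i s) i + a i) := by
    intro i
    have : Y = fun i => hT (fun s => (fun s i => y i s) s i) := by
      ext i; exact (hy i).symm
    rw [this, ← hT_tApply A (fun s i => y i s), hC_apply, ← map_add]; rfl
  have e2 : ∀ᶠ s in (hyperfilter ℕ : Filter ℕ), ∀ i, 0 ≤ tApply A (fun i => y i s) i + a i := by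
    rw [eventually_all]; intro i
    rw [← hT_le (f := fun _ => 0), ← hAY]
    exact f2 i
  have e3 : ∀ᶠ s in (hyperfilter ℕ : Filter ℕ),
      ∑ i, y i s * (tApply A (fun i => y i s) i + a i) = 0 := by
    simp only [hAY, ← hy, ← map_mul, ← map_sum] at f3
    rw [← map_zero hT, hT_eq] at f3
    simpa using f3
  have e4 : ∀ᶠ s in (hyperfilter ℕ : Filter ℕ), (∑ i, (y i s - x s i) ^ 2) ^ j ≤ δ s := by
    rw [abs_of_nonneg (Finset.sum_nonneg fun i _ => sq_nonneg _)] at hj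
    simp only [hwd, ← hy, hXd, ← map_mul, ← map_sub, ← map_pow, ← map_sum] at hj
    rw [← map_one hT, hT_le] at hj
    filter_upwards [hj] with s hs
    simp only [Pi.mul_apply, Pi.pow_apply, Finset.sum_apply, Pi.sub_apply, Pi.one_apply] at hs
    rwa [← div_eq_mul_inv, div_le_one (hδ s)] at hs
  filter_upwards [e1, e2, e3, e4] with s h1 h2 h3 h4
  exact ⟨fun i => y i s, ⟨h1, h2, h3⟩, h4⟩

end transfer

lemma tApply_smul {n k : ℕ} (A : Fin n → (Fin k → Fin n) → ℝ) (t : ℝ) (u : Fin n → ℝ) (i : Fin n) :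
    tApply A (t • u) i = t ^ k * tApply A u i := by
  simp only [tApply, Finset.mul_sum, Pi.smul_apply, smul_eq_mul, Finset.prod_mul_distrib]
  refine Finset.sum_congr rfl fun j _ => ?_
  simp
  ring

lemma sol_bdd {n k : ℕ} (hk : 1 ≤ k) (A : Fin n → (Fin k → Fin n) → ℝ) (hA : IsR0 A) (R : ℝ)
    (hR : 0 < R) : ∃ M : ℝ, ∀ b : Fin n → ℝ, (∀ i, |b i| ≤ R) → ∀ x ∈ Sol A b, ∀ i, |x i| ≤ M := by
  have hcA : ∀ i, Continuous fun u : Fin n → ℝ => tApply A u i := by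
    intro i; unfold tApply; fun_prop
  set r : (Fin n → ℝ) → ℝ := fun u => ∑ i, max (-(tApply A u i)) 0 + |∑ i, u i * tApply A u i|
    with hr
  have hrc : Continuous r := by fun_prop
  have hS : IsCompact (Metric.sphere (0 : Fin n → ℝ) 1 ∩ {u | ∀ i, 0 ≤ u i}) := by
    refine (isCompact_sphere _ _).inter_right ?_
    have : {u : Fin n → ℝ | ∀ i, 0 ≤ u i} = Set.Ici 0 := by
      ext u; rfl
    rw [this]; exact isClosed_Ici
  obtain ⟨ρ, hρ, hρr⟩ := hS.exists_forall_le' (f := r) hrc.continuousOn (a := 0) (by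
    rintro u ⟨hu1, hu2⟩
    have h1 : 0 ≤ ∑ i, max (-(tApply A u i)) 0 := Finset.sum_nonneg fun i _ => le_max_right _ _
    have h2 : 0 ≤ |∑ i, u i * tApply A u i| := abs_nonneg _
    refine lt_of_le_of_ne (add_nonneg h1 h2) fun h0 => ?_
    have h3 : ∑ i, max (-(tApply A u i)) 0 = 0 := by simp only [hr] at h0; linarith
    have h4 : |∑ i, u i * tApply A u i| = 0 := by simp only [hr] at h0; linarith
    rw [Finset.sum_eq_zero_iff_of_nonneg fun i _ => le_max_right _ _] at h3
    have : u ∈ Sol A 0 := by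
      refine ⟨hu2, fun i => ?_, ?_⟩
      · have := h3 i (Finset.mem_univ _)
        have h5 := le_max_left (-(tApply A u i)) 0
        simp; linarith
      · simpa using h4
    rw [hA] at this
    have hu0 : u = 0 := this
    rw [hu0] at hu1
    simp at hu1)
  refine ⟨max 1 (2 * n * R / ρ), fun b hb x hx i => ?_⟩
  rw [← Real.norm_eq_abs]
  refine (norm_le_pi_norm x i).trans ?_
  by_contra! hlt
  have ht1 : 1 < ‖x‖ := (le_max_left _ _).trans_lt hlt
  have ht2 : 2 * n * R / ρ < ‖x‖ := (le_max_right _ _).trans_lt hlt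
  set t := ‖x‖ with ht
  have ht0 : 0 < t := by linarith
  set u := t⁻¹ • x with hu
  have hxu : ∀ i, x i = t * u i := by intro i; simp [hu]; field_simp
  have hu0 : ∀ i, 0 ≤ u i := fun i => by
    simp only [hu, Pi.smul_apply, smul_eq_mul]; exact mul_nonneg (by positivity) (hx.1 i)
  have hun : ‖u‖ = 1 := by
    rw [hu, norm_smul, ← ht, norm_inv, Real.norm_of_nonneg ht0.le]; field_simp
  have hu1 : ∀ i, u i ≤ 1 := fun i => by
    have := norm_le_pi_norm u i
    rw [hun, Real.norm_eq_abs] at this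
    exact (le_abs_self _).trans this
  have hF : ∀ i, tApply A u i = (t⁻¹) ^ k * tApply A x i := fun i => tApply_smul A _ _ _
  set s := (t⁻¹) ^ k with hs
  have hs0 : 0 < s := by positivity
  have hst : s ≤ t⁻¹ := by
    have := pow_le_pow_of_le_one (by positivity) (inv_le_one_of_one_le₀ ht1.le) hk
    rw [pow_one] at this
    exact this
  have hb' := fun i => abs_le.1 (hb i)
  have k1 : ∑ i, max (-(tApply A u i)) 0 ≤ n * (s * R) := by
    have : ∀ i ∈ (Finset.univ : Finset (Fin n)), max (-(tApply A u i)) 0 ≤ s * R := by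
      intro i _
      refine max_le ?_ (by positivity)
      rw [hF, ← mul_neg]
      refine mul_le_mul_of_nonneg_left ?_ hs0.le
      linarith [hx.2.1 i, (hb' i).2]
    simpa using Finset.sum_le_sum this
  have k2 : |∑ i, u i * tApply A u i| ≤ n * (s * R) := by
    have e : ∑ i, u i * tApply A u i = - ∑ i, u i * (s * b i) := by
      have h := hx.2.2
      have h' : t * (∑ i, u i * tApply A u i + ∑ i, u i * (s * b i)) = 0 := by
        rw [← Finset.sum_add_distrib, Finset.mul_sum, ← mul_zero s, ← h, Finset.mul_sum]
        refine Finset.sum_congr rfl fun i _ => ?_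
        rw [hF, hxu]; ring
      have := (mul_eq_zero.1 h').resolve_left ht0.ne'
      linarith
    rw [e, abs_neg]
    refine (Finset.abs_sum_le_sum_abs _ _).trans ?_
    have : ∀ i ∈ (Finset.univ : Finset (Fin n)), |u i * (s * b i)| ≤ s * R := by
      intro i _
      rw [abs_mul, abs_mul, abs_of_nonneg (hu0 i), abs_of_pos hs0]
      have := mul_le_mul_of_nonneg_left (hb i) hs0.le
      have h0 : 0 ≤ s * |b i| := by positivity
      nlinarith [hu1 i, hu0 i]
    simpa using Finset.sum_le_sum this
  have k3 := hρr u ⟨by simpa using hun, hu0⟩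
  have k4 : ρ ≤ 2 * n * R * s := by simp only [hr] at k3; linarith
  have k5 : ρ ≤ 2 * n * R * t⁻¹ := k4.trans (mul_le_mul_of_nonneg_left hst (by positivity))
  rw [div_lt_iff₀ hρ] at ht2
  rw [← div_eq_mul_inv, le_div_iff₀ ht0] at k5
  linarith

lemma abs_le_eNorm {n : ℕ} (x : Fin n → ℝ) (i : Fin n) : |x i| ≤ eNorm x := by
  unfold eNorm
  rw [← Real.sqrt_sq_eq_abs]
  exact Real.sqrt_le_sqrt (Finset.single_le_sum (f := fun i => x i ^ 2)
    (fun i _ => sq_nonneg _) (Finset.mem_univ i))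

lemma eNorm_nonneg {n : ℕ} (x : Fin n → ℝ) : 0 ≤ eNorm x := Real.sqrt_nonneg _

lemma eNorm_sq {n : ℕ} (x : Fin n → ℝ) : eNorm x ^ 2 = ∑ i, x i ^ 2 :=
  Real.sq_sqrt (Finset.sum_nonneg fun i _ => sq_nonneg _)

lemma eNorm_smul {n : ℕ} (c : ℝ) (hc : 0 ≤ c) (x : Fin n → ℝ) : eNorm (c • x) = c * eNorm x := by
  have : ∑ i, (c • x) i ^ 2 = c ^ 2 * ∑ i, x i ^ 2 := by
    rw [Finset.mul_sum]; exact Finset.sum_congr rfl fun i _ => by simp; ring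
  unfold eNorm
  rw [this, Real.sqrt_mul (sq_nonneg c), Real.sqrt_sq hc]

lemma mem_add_smul {n : ℕ} (S : Set (Fin n → ℝ)) (x y : Fin n → ℝ) (hy : y ∈ S) (ρ : ℝ)
    (hρ : 0 < ρ) (h : eNorm (y - x) ≤ ρ) : x ∈ S + ρ • {x : Fin n → ℝ | eNorm x ≤ 1} := by
  refine Set.mem_add.2 ⟨y, hy, x - y, ?_, by simp⟩
  refine Set.mem_smul_set.2 ⟨ρ⁻¹ • (x - y), ?_, by rw [smul_smul, mul_inv_cancel₀ hρ.ne', one_smul]⟩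
  have : eNorm (x - y) = eNorm (y - x) := by
    unfold eNorm; congr 1; exact Finset.sum_congr rfl fun i _ => by simp; ring
  show eNorm _ ≤ 1
  rw [eNorm_smul _ (by positivity), this, inv_mul_le_iff₀ hρ, mul_one]
  exact h

/-- if `A` is R₀ and `Sol(A,a) ≠ ∅`, then `Sol_A` is locally upper-Hölder
at `a`. -/
theorem stmt_17 (m n : ℕ) (hm : 2 ≤ m) (hn : 2 ≤ n) (A : Fin n → (Fin (m - 1) → Fin n) → ℝ) (hA : IsR0 A)
    (a : Fin n → ℝ) (hne : (Sol A a).Nonempty) :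
    ∃ γ > (0 : ℝ), ∃ c > (0 : ℝ), ∃ ε > (0 : ℝ), ∀ b : Fin n → ℝ, eNorm (b - a) < ε →
      Sol A b ⊆ Sol A a +
        (γ * Real.rpow (eNorm (b - a)) c) • {x : Fin n → ℝ | eNorm x ≤ 1} := by
  by_contra hcon
  push Not at hcon
  have hpos : ∀ s : ℕ, (0 : ℝ) < 1 / ((s : ℝ) + 1) := fun s => by positivity
  choose b hb hnot using fun s : ℕ => hcon 1 one_pos (1 / ((s : ℝ) + 1)) (hpos s) _ (hpos s)
  choose x hx hxn using fun s => Set.not_subset.1 (hnot s)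
  have hδ : ∀ s, 0 < eNorm (b s - a) := by
    intro s
    refine lt_of_le_of_ne (eNorm_nonneg _) fun h0 => hxn s ?_
    have hba : b s = a := by
      ext i
      have := abs_le_eNorm (b s - a) i
      rw [← h0] at this
      have := abs_eq_zero.1 (le_antisymm this (abs_nonneg _))
      simpa [sub_eq_zero] using this
    have hr0 : Real.rpow (eNorm (b s - a)) (1 / ((s : ℝ) + 1)) = 0 := by
      rw [← h0]; exact Real.zero_rpow (hpos s).ne'
    rw [hr0, mul_zero]
    refine Set.mem_add.2 ⟨x s, hba ▸ hx s, 0, ?_, by simp⟩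
    exact Set.mem_smul_set.2 ⟨0, by simp [eNorm], by simp⟩
  have hδ1 : ∀ s, eNorm (b s - a) < 1 := fun s => (hb s).trans_le (by
    rw [div_le_one (by positivity)]; linarith [(Nat.cast_nonneg s : (0 : ℝ) ≤ s)])
  obtain ⟨M, hM⟩ := sol_bdd (k := m - 1) (by omega) A hA (eNorm a + 1)
    (by linarith [eNorm_nonneg a])
  have hxM : ∀ s i, |x s i| ≤ M := fun s => hM (b s) (fun i => by
    have h1 := abs_le_eNorm a i
    have h2 := (abs_le_eNorm (b s - a) i).trans (hδ1 s).le
    have h3 : b s i = a i + (b s - a) i := by simp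
    rw [h3]
    exact (abs_add_le _ _).trans (add_le_add h1 h2)) (x s) (hx s)
  obtain ⟨j, hj⟩ := main_seq A a M b x (fun s => eNorm (b s - a)) hδ hb
    (fun s i => abs_le_eNorm (b s - a) i) hx hxM
  have hlarge : ∀ᶠ s : ℕ in (Filter.hyperfilter ℕ : Filter ℕ), 2 * j ≤ s :=
    Nat.hyperfilter_le_atTop (Filter.eventually_ge_atTop _)
  obtain ⟨s, ⟨y, hy, hys⟩, hs⟩ := (hj.and hlarge).exists
  have hd := hδ s
  have hd1 := hδ1 s
  apply hxn s
  have hrp : 0 < Real.rpow (eNorm (b s - a)) (1 / ((s : ℝ) + 1)) := Real.rpow_pos_of_pos hd _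
  rw [one_mul]
  refine mem_add_smul _ _ y hy _ hrp ?_
  have e1 : eNorm (y - x s) ^ (2 * j) ≤ eNorm (b s - a) := by
    rw [pow_mul, eNorm_sq]; exact hys
  by_contra! hlt
  have hle1 : eNorm (y - x s) ^ (2 * j) ≤ 1 := e1.trans hd1.le
  set d := eNorm (b s - a) with hdd
  set q := Real.rpow d (1 / ((s : ℝ) + 1)) with hq
  have hqs : q ^ (s + 1) = d := by
    have : q = d ^ (1 / ((s : ℝ) + 1)) := rfl
    rw [this, ← Real.rpow_natCast, ← Real.rpow_mul hd.le]
    push_cast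
    rw [one_div, inv_mul_cancel₀ (by positivity), Real.rpow_one]
  have hq1 : q < 1 := Real.rpow_lt_one hd.le hd1 (hpos s)
  have : q ^ (s + 1) < q ^ (2 * j) := pow_lt_pow_right_of_lt_one₀ hrp hq1 (by omega)
  have h2 : q ^ (2 * j) ≤ eNorm (y - x s) ^ (2 * j) := pow_le_pow_left₀ hrp.le hlt.le _
  linarith
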